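/- Consider a collection H = {h₁,...,h_c} of hash functions h_i : U → V chosen uniformly and independently at random, with |U| = m sufficiently large and c ≥ 18·log m. Then with high probability H is a (c/6, 1/36)-expander: for every level 0 ≤ ℓ < log_k n, every set S ⊆ U with |S| ≤ n/(36·k^ℓ), and every (c/6)-bundle F of S, the union of servers ⋃_{(d,i)∈F} V(BF(v_i^{(ℓ)}(d))) has size at least k^ℓ·|S|. -/

import Mathlib

open Finset in
/-- Functions on `A` constrained to take values in `T` on `B` have density `(|T| / |V|) ^ |B|`. -/
theorem density_pi_mem {A V : Type*} [Fintype A] [DecidableEq A] [Fintype V] [DecidableEq V]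
    [Nonempty V] (B : Finset A) (T : Finset V) :
    ((univ.filter fun f : A → V => ∀ a ∈ B, f a ∈ T).card : ℝ) /
        (Fintype.card V : ℝ) ^ Fintype.card A =
      ((T.card : ℝ) / Fintype.card V) ^ B.card := by
  have hset : (univ.filter fun f : A → V => ∀ a ∈ B, f a ∈ T) =
      Fintype.piFinset fun a => if a ∈ B then T else univ := by
    ext f
    simp only [mem_filter, mem_univ, true_and, Fintype.mem_piFinset]
    refine forall_congr' fun a => ?_
    split_ifs with h <;> simp [h]
  have hV : (Fintype.card V : ℝ) ≠ 0 := by exact_mod_cast Fintype.card_ne_zero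
  have hpow : (Fintype.card V : ℝ) ^ Fintype.card A = ∏ _a : A, (Fintype.card V : ℝ) := by
    simp
  rw [hset, Fintype.card_piFinset, Nat.cast_prod, hpow, ← Finset.prod_div_distrib]
  have hfac : ∀ a : A, (((if a ∈ B then T else univ).card : ℝ) / (Fintype.card V : ℝ)) =
      if a ∈ B then (T.card : ℝ) / Fintype.card V else 1 := by
    intro a
    split_ifs
    · rfl
    · rw [Finset.card_univ, div_self hV]
  rw [Finset.prod_congr rfl fun a _ => hfac a, Finset.prod_ite_mem, Finset.univ_inter,
    Finset.prod_const]

open Finset in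
/-- The density of functions taking at least `b` of their values in `T`. -/
theorem density_le_card_mem_le {A V : Type*} [Fintype A] [DecidableEq A] [Fintype V]
    [DecidableEq V] [Nonempty V] (b : ℕ) (T : Finset V) :
    ((univ.filter fun f : A → V => b ≤ (univ.filter fun a => f a ∈ T).card).card : ℝ) /
        (Fintype.card V : ℝ) ^ Fintype.card A ≤
      (Fintype.card A).choose b * ((T.card : ℝ) / Fintype.card V) ^ b := by
  have hsub : (univ.filter fun f : A → V => b ≤ (univ.filter fun a => f a ∈ T).card) ⊆
      (powersetCard b univ).biUnion fun B : Finset A =>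
        univ.filter fun f : A → V => ∀ a ∈ B, f a ∈ T := by
    intro f hf
    obtain ⟨B, hB, hcard⟩ := Finset.exists_subset_card_eq (mem_filter.1 hf).2
    refine mem_biUnion.2 ⟨B, mem_powersetCard.2 ⟨subset_univ _, hcard⟩, ?_⟩
    exact mem_filter.2 ⟨mem_univ _, fun a ha => (mem_filter.1 (hB ha)).2⟩
  have hle : ((univ.filter fun f : A → V => b ≤ (univ.filter fun a => f a ∈ T).card).card : ℝ) ≤
      ∑ B ∈ powersetCard b (univ : Finset A),
        ((univ.filter fun f : A → V => ∀ a ∈ B, f a ∈ T).card : ℝ) := by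
    exact_mod_cast (card_le_card hsub).trans card_biUnion_le
  calc _ ≤ (∑ B ∈ powersetCard b (univ : Finset A),
        ((univ.filter fun f : A → V => ∀ a ∈ B, f a ∈ T).card : ℝ)) /
          (Fintype.card V : ℝ) ^ Fintype.card A := by gcongr
    _ = ∑ B ∈ powersetCard b (univ : Finset A), ((T.card : ℝ) / Fintype.card V) ^ b := by
        rw [Finset.sum_div]
        refine Finset.sum_congr rfl fun B hB => ?_
        rw [density_pi_mem, (mem_powersetCard.1 hB).2]
    _ = _ := by simp

open Finset in
/-- The density of hash families sending at least `b` of the copies of every `d ∈ S` into `T`. -/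
theorem density_forall_le_card_mem_le {A U V : Type*} [Fintype A] [DecidableEq A] [Fintype U]
    [DecidableEq U] [Fintype V] [DecidableEq V] [Nonempty V] (b : ℕ) (S : Finset U)
    (T : Finset V) :
    ((univ.filter fun h : A → U → V =>
        ∀ d ∈ S, b ≤ (univ.filter fun i => h i d ∈ T).card).card : ℝ) /
        (Fintype.card V : ℝ) ^ (Fintype.card A * Fintype.card U) ≤
      ((Fintype.card A).choose b * ((T.card : ℝ) / Fintype.card V) ^ b) ^ S.card := by
  have hcard : (univ.filter fun h : A → U → V =>
        ∀ d ∈ S, b ≤ (univ.filter fun i => h i d ∈ T).card).card =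
      (univ.filter fun g : U → A → V => ∀ d ∈ S, g d ∈
        univ.filter fun f : A → V => b ≤ (univ.filter fun a => f a ∈ T).card).card := by
    refine Finset.card_equiv (Equiv.piComm fun _ _ => V) fun h => ?_
    simp [Function.swap]
  have hpi := density_pi_mem S
    (univ.filter fun f : A → V => b ≤ (univ.filter fun a => f a ∈ T).card)
  rw [Fintype.card_fun, Nat.cast_pow, ← pow_mul] at hpi
  rw [hcard, hpi]
  exact pow_le_pow_left₀ (by positivity) (density_le_card_mem_le b T) _

open Finset in
theorem card_filter_mem_of_card_fiber {V W : Type*} [Fintype V] [Fintype W] [DecidableEq W]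
    (π : V → W) {q : ℕ} (hπ : ∀ w, (univ.filter fun v => π v = w).card = q) (T : Finset W) :
    (univ.filter fun v => π v ∈ T).card = T.card * q := by
  rw [Finset.card_eq_sum_card_fiberwise (f := π) (t := T) (fun v hv => by simpa using hv),
    Finset.sum_const_nat]
  intro w hw
  rw [← hπ w, Finset.filter_filter]
  congr 1
  ext v
  simp only [mem_filter, mem_univ, true_and]
  exact ⟨fun h => h.2, fun h => ⟨h ▸ hw, h⟩⟩

open Finset in
/-- If `π : V → W` has fibers of constant size, hash families for which some `T ⊆ W` of size `t`
captures at least `b` copies of every `d ∈ S` are rare. -/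
theorem density_exists_card_eq_le {A U V W : Type*} [Fintype A] [DecidableEq A] [Fintype U]
    [DecidableEq U] [Fintype V] [DecidableEq V] [Nonempty V] [Fintype W] [DecidableEq W]
    (π : V → W) {q : ℕ} (hπ : ∀ w, (univ.filter fun v => π v = w).card = q)
    (b t : ℕ) (S : Finset U) :
    ((univ.filter fun h : A → U → V => ∃ T : Finset W, T.card = t ∧
        ∀ d ∈ S, b ≤ (univ.filter fun i => π (h i d) ∈ T).card).card : ℝ) /
        (Fintype.card V : ℝ) ^ (Fintype.card A * Fintype.card U) ≤
      (Fintype.card W).choose t *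
        ((Fintype.card A).choose b * ((t : ℝ) / Fintype.card W) ^ b) ^ S.card := by
  have hpre := card_filter_mem_of_card_fiber π hπ
  have hV : Fintype.card V = Fintype.card W * q := by simpa using hpre univ
  have hq : (q : ℝ) ≠ 0 := by
    have : Fintype.card V ≠ 0 := Fintype.card_ne_zero
    rw [hV] at this
    exact_mod_cast (mul_ne_zero_iff.1 this).2
  have hsub : (univ.filter fun h : A → U → V => ∃ T : Finset W, T.card = t ∧
        ∀ d ∈ S, b ≤ (univ.filter fun i => π (h i d) ∈ T).card) ⊆
      (powersetCard t univ).biUnion fun T : Finset W => univ.filter fun h : A → U → V =>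
        ∀ d ∈ S, b ≤ (univ.filter fun i => h i d ∈ univ.filter fun v => π v ∈ T).card := by
    intro h hh
    obtain ⟨T, hT, hb⟩ := (mem_filter.1 hh).2
    refine mem_biUnion.2 ⟨T, mem_powersetCard.2 ⟨subset_univ _, hT⟩, ?_⟩
    simpa using hb
  have hle := (card_le_card hsub).trans card_biUnion_le
  calc _ ≤ (∑ T ∈ powersetCard t (univ : Finset W), ((univ.filter fun h : A → U → V =>
        ∀ d ∈ S, b ≤ (univ.filter fun i => h i d ∈
          univ.filter fun v => π v ∈ T).card).card : ℝ)) /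
          (Fintype.card V : ℝ) ^ (Fintype.card A * Fintype.card U) := by
        gcongr
        exact_mod_cast hle
    _ ≤ ∑ T ∈ powersetCard t (univ : Finset W),
        ((Fintype.card A).choose b * ((t : ℝ) / Fintype.card W) ^ b) ^ S.card := by
        rw [Finset.sum_div]
        refine Finset.sum_le_sum fun T hT => ?_
        refine (density_forall_le_card_mem_le b S _).trans_eq ?_
        rw [hpre, (mem_powersetCard.1 hT).2, hV, Nat.cast_mul, Nat.cast_mul,
          mul_div_mul_right _ _ hq]
    _ = _ := by simp

/-- The union bound term for `t` blocks out of `N` capturing `(a + 1) (t + 1)` hash values. -/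
theorem choose_mul_div_pow_le {N t a : ℕ} (hN : 36 * (t + 1) ≤ N) :
    (N.choose t : ℝ) * ((t : ℝ) / N) ^ ((a + 1) * (t + 1)) ≤
      Real.exp (-(a + 1 : ℝ)) / 36 * (36 * (t + 1) / N) * (Real.exp 1 / 36 ^ a) ^ (t + 1) := by
  have hN0 : (0 : ℝ) < N := by exact_mod_cast (show 0 < N by omega)
  have hx1 : 36 * ((t : ℝ) + 1) / N ≤ 1 := by
    rw [div_le_one hN0]
    exact_mod_cast hN
  have hchoose : (N.choose t : ℝ) * ((t : ℝ) / N) ^ t ≤ Real.exp t := by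
    calc (N.choose t : ℝ) * ((t : ℝ) / N) ^ t
        ≤ (N : ℝ) ^ t / t.factorial * ((t : ℝ) / N) ^ t := by
          gcongr
          exact Nat.choose_le_pow_div t N
      _ = (t : ℝ) ^ t / t.factorial := by
          rw [div_pow]
          field_simp
      _ ≤ Real.exp t := Real.pow_div_factorial_le_exp _ (by positivity) _
  have hratio : ((t : ℝ) / (t + 1)) ^ (t + 1) ≤ Real.exp (-1) := by
    have h1 : (t : ℝ) / (t + 1) ≤ Real.exp (-(1 / (t + 1))) := by
      refine le_trans (le_of_eq ?_) (Real.add_one_le_exp _)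
      field_simp
      ring
    calc ((t : ℝ) / (t + 1)) ^ (t + 1) ≤ Real.exp (-(1 / (t + 1))) ^ (t + 1) := by gcongr
      _ = Real.exp (-1) := by
        rw [← Real.exp_nat_mul]
        congr 1
        push_cast
        field_simp
  set x : ℝ := 36 * ((t : ℝ) + 1) / N with hx
  have hx0 : 0 ≤ x := by positivity
  have hsplit : (t : ℝ) / N = t / (t + 1) * (x / 36) := by
    rw [hx]
    field_simp
  have hrest : ((t : ℝ) / N) ^ (a * (t + 1) + 1) ≤
      Real.exp (-a) * (x / 36) * (1 / 36 ^ a) ^ (t + 1) := by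
    have h1 : ((t : ℝ) / (t + 1)) ^ (a * (t + 1) + 1) ≤ Real.exp (-a) := by
      calc ((t : ℝ) / (t + 1)) ^ (a * (t + 1) + 1) ≤ ((t : ℝ) / (t + 1)) ^ (a * (t + 1)) := by
            refine pow_le_pow_of_le_one (by positivity) ?_ (Nat.le_succ _)
            rw [div_le_one (by positivity)]
            linarith
        _ = (((t : ℝ) / (t + 1)) ^ (t + 1)) ^ a := by rw [← pow_mul, mul_comm]
        _ ≤ Real.exp (-1) ^ a := by gcongr
        _ = Real.exp (-a) := by
            rw [← Real.exp_nat_mul]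
            congr 1
            ring
    have h2 : (x / 36) ^ (a * (t + 1) + 1) ≤ x / 36 * (1 / 36 ^ a) ^ (t + 1) := by
      rw [pow_succ', pow_mul]
      gcongr
      rw [div_pow]
      gcongr
      exact pow_le_one₀ hx0 hx1
    calc ((t : ℝ) / N) ^ (a * (t + 1) + 1)
        = ((t : ℝ) / (t + 1)) ^ (a * (t + 1) + 1) * (x / 36) ^ (a * (t + 1) + 1) := by
          rw [hsplit, mul_pow]
      _ ≤ Real.exp (-a) * (x / 36 * (1 / 36 ^ a) ^ (t + 1)) := by gcongr
      _ = _ := by ring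
  calc (N.choose t : ℝ) * ((t : ℝ) / N) ^ ((a + 1) * (t + 1))
      = (N.choose t * ((t : ℝ) / N) ^ t) * ((t : ℝ) / N) ^ (a * (t + 1) + 1) := by
        rw [mul_assoc, ← pow_add]
        congr 2
        ring
    _ ≤ Real.exp t * (Real.exp (-a) * (x / 36) * (1 / 36 ^ a) ^ (t + 1)) := by gcongr
    _ = Real.exp (-(a + 1 : ℝ)) / 36 * x * (Real.exp 1 / 36 ^ a) ^ (t + 1) := by
        have h1 : Real.exp t = Real.exp (-1) * Real.exp 1 ^ (t + 1) := by
          rw [← Real.exp_nat_mul, ← Real.exp_add]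
          congr 1
          push_cast
          ring
        have h2 : Real.exp (-(a + 1 : ℝ)) = Real.exp (-a) * Real.exp (-1) := by
          rw [← Real.exp_add]
          congr 1
          ring
        rw [h1, h2, div_eq_mul_one_div (Real.exp 1), mul_pow (Real.exp 1)]
        ring

/-- A truncated geometric sum is dominated by twice its last admissible term. -/
theorem sum_filter_mul_pow_le {k : ℕ} (hk : 2 ≤ k) (M n L : ℕ) :
    ∑ l ∈ (Finset.range L).filter (fun l => M * k ^ l ≤ n), M * k ^ l ≤ 2 * n := by
  suffices h : ∑ l ∈ (Finset.range L).filter (fun l => M * k ^ l ≤ n), M * k ^ l ≤ 2 * n ∧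
      ∑ l ∈ (Finset.range L).filter (fun l => M * k ^ l ≤ n), M * k ^ l ≤ M * k ^ L from h.1
  induction L with
  | zero => simp
  | succ L ih =>
    have hstep : 2 * (M * k ^ L) ≤ M * k ^ (L + 1) := by
      rw [pow_succ]
      nlinarith [Nat.zero_le (M * k ^ L)]
    rw [Finset.range_add_one, Finset.filter_insert]
    split_ifs with h
    · rw [Finset.sum_insert (by simp)]
      omega
    · omega

theorem choose_six_mul_succ_le (b : ℕ) :
    (6 * (b + 1)).choose (b + 1) ≤ 15 * (6 * b).choose b := by
  have hstep : ∀ n, 6 * b ≤ n → 5 * (n + 1).choose b ≤ 6 * n.choose b := by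
    intro n hn
    have h := Nat.choose_mul_succ_eq n b
    obtain ⟨r, hr⟩ : ∃ r, n + 1 = r + 1 + b := ⟨n - b, by omega⟩
    have hsub : n + 1 - b = r + 1 := by omega
    rw [hsub] at h
    have h5 : 5 * (n + 1) ≤ 6 * (r + 1) := by omega
    refine Nat.le_of_mul_le_mul_right (c := r + 1) ?_ (by omega)
    nlinarith [Nat.mul_le_mul_left (n.choose b) h5]
  have h1 : 5 * (6 * b + 1).choose b ≤ 6 * (6 * b).choose b := hstep (6 * b) le_rfl
  have h2 : 5 * (6 * b + 2).choose b ≤ 6 * (6 * b + 1).choose b := hstep (6 * b + 1) (by omega)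
  have h3 : 5 * (6 * b + 3).choose b ≤ 6 * (6 * b + 2).choose b := hstep (6 * b + 2) (by omega)
  have h4 : 5 * (6 * b + 4).choose b ≤ 6 * (6 * b + 3).choose b := hstep (6 * b + 3) (by omega)
  have h5 : 5 * (6 * b + 5).choose b ≤ 6 * (6 * b + 4).choose b := hstep (6 * b + 4) (by omega)
  have h6 : (6 * (b + 1)).choose (b + 1) = 6 * (6 * b + 5).choose b := by
    have h := Nat.add_one_mul_choose_eq (6 * b + 5) b
    refine Nat.eq_of_mul_eq_mul_right (Nat.succ_pos b) ?_
    have e : 6 * (b + 1) = 6 * b + 5 + 1 := by ring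
    rw [e]
    linarith
  omega

theorem exp_mul_choose_six_mul_le {b : ℕ} (hb : 3 ≤ b) :
    Real.exp (b / 3) * ((6 * b).choose b * (Real.exp 1 / 36 ^ (b - 1))) ≤ 14 / 3 := by
  induction b, hb using Nat.le_induction with
  | base =>
    have hchoose : (6 * 3).choose 3 = 816 := by decide
    rw [hchoose]
    norm_num
    nlinarith [Real.exp_one_lt_d9, Real.exp_pos 1]
  | succ b hb ih =>
    refine le_trans ?_ ih
    have hc : ((6 * (b + 1)).choose (b + 1) : ℝ) ≤ 15 * (6 * b).choose b := by
      exact_mod_cast choose_six_mul_succ_le b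
    have he : Real.exp ((b + 1 : ℕ) / 3) = Real.exp (b / 3) * Real.exp (1 / 3) := by
      rw [← Real.exp_add]
      congr 1
      push_cast
      ring
    have h13 : Real.exp (1 / 3) ≤ 2 := by
      have : Real.exp (1 / 3) ≤ Real.exp (Real.log 2) := by
        gcongr
        linarith [Real.log_two_gt_d9]
      rwa [Real.exp_log (by norm_num)] at this
    have hpow : (36 : ℝ) ^ (b + 1 - 1) = 36 ^ (b - 1) * 36 := by
      rw [← pow_succ]
      congr 1
      omega
    rw [he, hpow]
    calc Real.exp (b / 3) * Real.exp (1 / 3) *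
          ((6 * (b + 1)).choose (b + 1) * (Real.exp 1 / (36 ^ (b - 1) * 36)))
        ≤ Real.exp (b / 3) * 2 *
          (15 * (6 * b).choose b * (Real.exp 1 / (36 ^ (b - 1) * 36))) := by gcongr
      _ = 30 / 36 * (Real.exp (b / 3) *
          ((6 * b).choose b * (Real.exp 1 / 36 ^ (b - 1)))) := by
          field_simp
          ring
      _ ≤ _ := mul_le_of_le_one_left (by positivity) (by norm_num)

theorem exp_neg_mul_one_add_pow_le {m b : ℕ} (hm : 0 < m) (hb : 3 ≤ b)
    (hmb : (m : ℝ) ≤ Real.exp (b / 3)) :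
    Real.exp (-b) / 18 * (1 + (6 * b).choose b * (Real.exp 1 / 36 ^ (b - 1))) ^ m ≤ 1 / m := by
  set y : ℝ := (6 * b).choose b * (Real.exp 1 / 36 ^ (b - 1)) with hy
  have hy0 : 0 ≤ y := by positivity
  have hm0 : (0 : ℝ) < m := by exact_mod_cast hm
  have hmy : m * y ≤ 14 / 3 :=
    (mul_le_mul_of_nonneg_right hmb hy0).trans (exp_mul_choose_six_mul_le hb)
  have hpow : (1 + y) ^ m ≤ Real.exp (14 / 3) := by
    calc (1 + y) ^ m ≤ Real.exp y ^ m := by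
          gcongr
          linarith [Real.add_one_le_exp y]
      _ = Real.exp (m * y) := by rw [← Real.exp_nat_mul]
      _ ≤ _ := by gcongr
  have h83 : Real.exp (8 / 3) ≤ 18 := by
    have h3 : Real.exp (8 / 3) ^ 3 = Real.exp 1 ^ 8 := by
      rw [← Real.exp_nat_mul, ← Real.exp_nat_mul]
      norm_num
    have h8 : Real.exp 1 ^ 8 ≤ (2.72 : ℝ) ^ 8 := by
      gcongr
      linarith [Real.exp_one_lt_d9]
    refine le_of_pow_le_pow_left₀ (n := 3) (by norm_num) (by norm_num) ?_
    rw [h3]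
    exact h8.trans (by norm_num)
  have hb3 : (3 : ℝ) ≤ b := by exact_mod_cast hb
  rw [le_div_iff₀ hm0]
  calc Real.exp (-b) / 18 * (1 + y) ^ m * m
      ≤ Real.exp (-b) / 18 * Real.exp (14 / 3) * Real.exp (b / 3) := by gcongr
    _ = Real.exp (-b + 14 / 3 + b / 3) / 18 := by
        rw [Real.exp_add, Real.exp_add]
        ring
    _ ≤ Real.exp (8 / 3) / 18 := by
        gcongr
        linarith
    _ ≤ 1 := by linarith

/-- The block of level `l` containing a server: its coordinates from `l` on. -/
def butterflyBlock {k D : ℕ} (l : Fin D) (v : Fin D → Fin k) :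
    {j : Fin D // (l : ℕ) ≤ j} → Fin k :=
  fun j => v j

open Finset in
theorem card_butterflyBlock_fiber {k D : ℕ} (l : Fin D)
    (w : {j : Fin D // (l : ℕ) ≤ j} → Fin k) :
    (univ.filter fun v : Fin D → Fin k => butterflyBlock l v = w).card = k ^ (l : ℕ) := by
  have hset : (univ.filter fun v : Fin D → Fin k => butterflyBlock l v = w) =
      Fintype.piFinset fun j : Fin D => if hj : (l : ℕ) ≤ j then {w ⟨j, hj⟩} else univ := by
    ext v
    simp only [mem_filter, mem_univ, true_and, Fintype.mem_piFinset, funext_iff, Subtype.forall,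
      butterflyBlock]
    refine forall_congr' fun j => ?_
    split_ifs with hj <;> simp [hj]
  have hcard : ∀ j : Fin D,
      (if hj : (l : ℕ) ≤ j then ({w ⟨j, hj⟩} : Finset (Fin k)) else univ).card =
        if j ∈ Iio l then k else 1 := by
    intro j
    by_cases hj : (l : ℕ) ≤ j
    · rw [dif_pos hj, if_neg fun h : j ∈ Iio l => absurd (mem_Iio.1 h) (not_lt.2 hj),
        card_singleton]
    · rw [dif_neg hj, if_pos (show j ∈ Iio l from mem_Iio.2 (not_le.1 hj)), card_univ, Fintype.card_fin]
  rw [hset, Fintype.card_piFinset, Finset.prod_congr rfl fun j _ => hcard j,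
    Finset.prod_ite_mem, Finset.univ_inter, Finset.prod_const, Fin.card_Iio]

theorem card_butterflyBlock_mul {k D : ℕ} (l : Fin D) :
    Fintype.card ({j : Fin D // (l : ℕ) ≤ j} → Fin k) * k ^ (l : ℕ) = k ^ D := by
  have h := card_filter_mem_of_card_fiber (butterflyBlock l)
    (card_butterflyBlock_fiber (k := k) l) Finset.univ
  simpa using h.symm

open Finset in
/-- The hash families for which some `|S| - 1` blocks of level `l` capture at least `b` hash
values of every key of `S`. -/
def captured {k D c : ℕ} {U : Type} [Fintype U] [DecidableEq U] (b : ℕ) (l : Fin D)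
    (S : Finset U) : Finset (Fin c → U → (Fin D → Fin k)) :=
  univ.filter fun h => ∃ T : Finset ({j : Fin D // (l : ℕ) ≤ j} → Fin k), T.card = S.card - 1 ∧
    ∀ d ∈ S, b ≤ (univ.filter fun i => butterflyBlock l (h i d) ∈ T).card

open Finset in
theorem mem_captured_of_card_lt {k D c b : ℕ} {U : Type} [Fintype U] [DecidableEq U]
    {h : Fin c → U → (Fin D → Fin k)} {l : Fin D} {S : Finset U} {F : Finset (U × Fin c)}
    (hk : 0 < k) (hF : ∀ d ∈ S, (F.filter fun p => p.1 = d).card = b)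
    (hS : S.card * k ^ (l : ℕ) ≤ k ^ D)
    (hlt : (univ.filter fun s : Fin D → Fin k =>
      ∃ p ∈ F, ∀ j : Fin D, (l : ℕ) ≤ (j : ℕ) → s j = h p.2 p.1 j).card <
        k ^ (l : ℕ) * S.card) :
    h ∈ captured b l S := by
  set T₀ := F.image fun p => butterflyBlock l (h p.2 p.1) with hT₀
  have hset : (univ.filter fun s : Fin D → Fin k =>
      ∃ p ∈ F, ∀ j : Fin D, (l : ℕ) ≤ (j : ℕ) → s j = h p.2 p.1 j) =
      univ.filter fun s => butterflyBlock l s ∈ T₀ := by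
    ext s
    simp only [hT₀, mem_filter, mem_univ, true_and, mem_image]
    refine exists_congr fun p => and_congr_right fun _ => ?_
    rw [eq_comm (a := butterflyBlock l (h p.2 p.1)), funext_iff, Subtype.forall]
    rfl
  have hpos : 0 < k ^ (l : ℕ) := by positivity
  rw [hset, card_filter_mem_of_card_fiber _ (card_butterflyBlock_fiber l), mul_comm] at hlt
  have hcard : T₀.card < S.card := lt_of_mul_lt_mul_left' hlt
  have hN : S.card ≤ Fintype.card ({j : Fin D // (l : ℕ) ≤ j} → Fin k) := by
    rw [← card_butterflyBlock_mul l] at hS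
    exact Nat.le_of_mul_le_mul_right hS hpos
  obtain ⟨T, hsub, -, hT⟩ := Finset.exists_subsuperset_card_eq (subset_univ T₀)
    (n := S.card - 1) (by omega) (by rw [card_univ]; omega)
  refine mem_filter.2 ⟨mem_univ _, T, hT, fun d hd => ?_⟩
  rw [← hF d hd]
  refine Finset.card_le_card_of_injOn Prod.snd ?_ ?_
  · intro p hp
    obtain ⟨hpF, rfl⟩ := mem_filter.1 hp
    exact mem_filter.2 ⟨mem_univ _, hsub (mem_image_of_mem _ hpF)⟩
  · intro p hp p' hp' hpp'
    exact Prod.ext ((mem_filter.1 hp).2.trans (mem_filter.1 hp').2.symm) hpp'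

theorem density_captured_le {k D b : ℕ} {U : Type} [Fintype U] [DecidableEq U] (hk : 0 < k)
    (hb : 0 < b) (l : Fin D) {S : Finset U} (hS : S.Nonempty)
    (hSk : 36 * S.card * k ^ (l : ℕ) ≤ k ^ D) :
    ((captured (k := k) (c := 6 * b) b l S).card : ℝ) /
        ((k : ℝ) ^ D) ^ (6 * b * Fintype.card U) ≤
      Real.exp (-b) / 36 * (((36 * S.card * k ^ (l : ℕ) : ℕ) : ℝ) / (k : ℝ) ^ D) *
        ((6 * b).choose b * (Real.exp 1 / 36 ^ (b - 1))) ^ S.card := by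
  have : Nonempty (Fin k) := ⟨⟨0, hk⟩⟩
  obtain ⟨a, rfl⟩ : ∃ a, b = a + 1 := ⟨b - 1, by omega⟩
  obtain ⟨t, ht⟩ : ∃ t, S.card = t + 1 := ⟨S.card - 1, by have := hS.card_pos; omega⟩
  have hcap := density_exists_card_eq_le (A := Fin (6 * (a + 1))) (butterflyBlock l)
    (card_butterflyBlock_fiber (k := k) l) (a + 1) (S.card - 1) S
  have hN := card_butterflyBlock_mul (k := k) l
  set N := Fintype.card ({j : Fin D // (l : ℕ) ≤ j} → Fin k)
  have hpos : 0 < k ^ (l : ℕ) := by positivity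
  have htN : 36 * (t + 1) ≤ N := by
    rw [← hN, ht] at hSk
    exact Nat.le_of_mul_le_mul_right hSk hpos
  have hterm := choose_mul_div_pow_le (a := a) htN
  have hfrac : 36 * ((t : ℝ) + 1) / N =
      ((36 * S.card * k ^ (l : ℕ) : ℕ) : ℝ) / (k : ℝ) ^ D := by
    have hD : (k : ℝ) ^ D = N * (k : ℝ) ^ (l : ℕ) := by exact_mod_cast hN.symm
    have hne : (k : ℝ) ^ (l : ℕ) ≠ 0 := by exact_mod_cast hpos.ne'
    rw [hD, ht]
    push_cast
    rw [mul_div_mul_right _ _ hne]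
  simp only [Fintype.card_fun, Fintype.card_fin, Nat.cast_pow] at hcap
  refine hcap.trans ?_
  rw [← hfrac, ht, Nat.add_sub_cancel, Nat.add_sub_cancel, mul_pow, mul_pow, ← pow_mul]
  calc (N.choose t : ℝ) * (((6 * (a + 1)).choose (a + 1) : ℝ) ^ (t + 1) *
        ((t : ℝ) / N) ^ ((a + 1) * (t + 1)))
      = ((6 * (a + 1)).choose (a + 1) : ℝ) ^ (t + 1) *
        (N.choose t * ((t : ℝ) / N) ^ ((a + 1) * (t + 1))) := by ring
    _ ≤ ((6 * (a + 1)).choose (a + 1) : ℝ) ^ (t + 1) * (Real.exp (-(a + 1 : ℝ)) / 36 *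
        (36 * (t + 1) / N) * (Real.exp 1 / 36 ^ a) ^ (t + 1)) := by gcongr
    _ = _ := by
        push_cast
        ring

open Finset in
/-- The union bound over all levels for a fixed set of keys. -/
theorem sum_density_captured_le {k D b : ℕ} {U : Type} [Fintype U] [DecidableEq U] (hk : 2 ≤ k)
    (hb : 0 < b) {S : Finset U} (hS : S.Nonempty) :
    ∑ l ∈ univ.filter (fun l : Fin D => 36 * S.card * k ^ (l : ℕ) ≤ k ^ D),
        ((captured (k := k) (c := 6 * b) b l S).card : ℝ) /
          ((k : ℝ) ^ D) ^ (6 * b * Fintype.card U) ≤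
      Real.exp (-b) / 18 * ((6 * b).choose b * (Real.exp 1 / 36 ^ (b - 1))) ^ S.card := by
  set y : ℝ := (6 * b).choose b * (Real.exp 1 / 36 ^ (b - 1)) with hy
  have hgeom : ∑ l ∈ univ.filter (fun l : Fin D => 36 * S.card * k ^ (l : ℕ) ≤ k ^ D),
      36 * S.card * k ^ (l : ℕ) ≤ 2 * k ^ D := by
    have h := sum_filter_mul_pow_le hk (36 * S.card) (k ^ D) D
    rw [Finset.sum_filter] at h ⊢
    rwa [Fin.sum_univ_eq_sum_range
      (fun l => if 36 * S.card * k ^ l ≤ k ^ D then 36 * S.card * k ^ l else 0) D]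
  have hD : (0 : ℝ) < (k : ℝ) ^ D := by
    have : (0 : ℝ) < k := by exact_mod_cast (show 0 < k by omega)
    positivity
  calc _ ≤ ∑ l ∈ univ.filter (fun l : Fin D => 36 * S.card * k ^ (l : ℕ) ≤ k ^ D),
        Real.exp (-b) / 36 * (((36 * S.card * k ^ (l : ℕ) : ℕ) : ℝ) / (k : ℝ) ^ D) *
          y ^ S.card :=
        Finset.sum_le_sum fun l hl =>
          density_captured_le (by omega) hb l hS (mem_filter.1 hl).2
    _ = Real.exp (-b) / 36 *
        (((∑ l ∈ univ.filter (fun l : Fin D => 36 * S.card * k ^ (l : ℕ) ≤ k ^ D),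
          36 * S.card * k ^ (l : ℕ) : ℕ) : ℝ) / (k : ℝ) ^ D) * y ^ S.card := by
        rw [← Finset.sum_mul, ← Finset.mul_sum, ← Finset.sum_div, Nat.cast_sum]
    _ ≤ Real.exp (-b) / 36 * 2 * y ^ S.card := by
        gcongr
        rw [div_le_iff₀ hD]
        exact_mod_cast hgeom
    _ = _ := by ring


/-- A collection `h = (h₁, …, h_c)` of hash functions `U → V` (with `V` the `n = k^D`
servers of a `k`-ary butterfly, identified with `Fin D → Fin k`) chosen uniformly and
independently at random is, with probability at least `1 - 1/m`, a `(c/6, 1/36)`-expander: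
for every level `ℓ < D`, every `S ⊆ U` with `|S| ≤ n/(36 k^ℓ)` and every `(c/6)`-bundle
`F` of `S`, the union of the sub-butterflies `BF(v_i^{(ℓ)}(d))` for `(d,i) ∈ F` (the
servers agreeing with `h_i(d)` on all coordinates `≥ ℓ`) contains at least `k^ℓ·|S|`
servers. (Uniform counting probability over all hash families.) -/
theorem stmt5 {k D c m : ℕ} (U : Type) [Fintype U] [DecidableEq U]
    (hU : Fintype.card U = m) (hk : 2 ≤ k) (hm : 2 ≤ m)
    (hc : 18 * Real.log m ≤ (c : ℝ)) :
    1 - 1 / (m : ℝ) ≤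
      (((Finset.univ : Finset (Fin c → U → (Fin D → Fin k))).filter
          (fun h => ∀ ℓ : Fin D, ∀ S : Finset U, ∀ F : Finset (U × Fin c),
            (∀ d ∈ S, (F.filter fun p => p.1 = d).card * 6 = c) →
            (∀ p ∈ F, p.1 ∈ S) →
            36 * S.card * k ^ (ℓ : ℕ) ≤ k ^ D →
            k ^ (ℓ : ℕ) * S.card ≤
              (Finset.univ.filter fun s : Fin D → Fin k =>
                ∃ p ∈ F, ∀ j : Fin D, (ℓ : ℕ) ≤ (j : ℕ) → s j = h p.2 p.1 j).card)).card : ℝ)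
        / ((k : ℝ) ^ D) ^ (c * m) := by
  classical
  set good := fun h : Fin c → U → (Fin D → Fin k) =>
    ∀ ℓ : Fin D, ∀ S : Finset U, ∀ F : Finset (U × Fin c),
      (∀ d ∈ S, (F.filter fun p => p.1 = d).card * 6 = c) →
      (∀ p ∈ F, p.1 ∈ S) →
      36 * S.card * k ^ (ℓ : ℕ) ≤ k ^ D →
      k ^ (ℓ : ℕ) * S.card ≤
        (Finset.univ.filter fun s : Fin D → Fin k =>
          ∃ p ∈ F, ∀ j : Fin D, (ℓ : ℕ) ≤ (j : ℕ) → s j = h p.2 p.1 j).card with hgood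
  have hm0 : (0 : ℝ) < m := by exact_mod_cast (show 0 < m by omega)
  have hk0 : (0 : ℝ) < k := by exact_mod_cast (show 0 < k by omega)
  set total : ℝ := ((k : ℝ) ^ D) ^ (c * m) with htotal
  have htotal0 : 0 < total := by positivity
  have hsum : ((Finset.univ.filter good).card : ℝ) +
      (Finset.univ.filter fun h => ¬ good h).card = total := by
    have h := Finset.card_filter_add_card_filter_not (s := Finset.univ) good
    have hcard : (Finset.univ : Finset (Fin c → U → (Fin D → Fin k))).card =
        (k ^ D) ^ (c * m) := by
      simp [hU, ← pow_mul, mul_comm, mul_left_comm]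
    rw [hcard] at h
    rw [htotal]
    exact_mod_cast h
  suffices hbad : ((Finset.univ.filter fun h => ¬ good h).card : ℝ) / total ≤ 1 / m by
    have hdiv : ((Finset.univ.filter good).card : ℝ) / total =
        1 - ((Finset.univ.filter fun h => ¬ good h).card : ℝ) / total := by
      rw [eq_sub_iff_add_eq, ← add_div, hsum, div_self htotal0.ne']
    rw [hdiv]
    linarith
  by_cases hdvd : 6 ∣ c
  swap
  · have hempty : (Finset.univ.filter fun h => ¬ good h) = ∅ := by
      refine Finset.filter_eq_empty_iff.2 fun h _ => not_not.2 ?_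
      intro ℓ S F hF _ _
      rcases S.eq_empty_or_nonempty with rfl | ⟨d, hd⟩
      · simp
      · exact absurd (Dvd.intro_left _ (hF d hd)) hdvd
    rw [hempty]
    simp
  obtain ⟨b, rfl⟩ := hdvd
  have hlog : Real.log m ≤ b / 3 := by
    push_cast at hc
    linarith
  have hmb : (m : ℝ) ≤ Real.exp (b / 3) := (Real.log_le_iff_le_exp hm0).1 hlog
  have hb : 3 ≤ b := by
    have h2 : Real.log 2 ≤ Real.log m := by
      gcongr
      exact_mod_cast hm
    have : (2 : ℝ) < b := by linarith [Real.log_two_gt_d9]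
    exact_mod_cast this
  set y : ℝ := (6 * b).choose b * (Real.exp 1 / 36 ^ (b - 1)) with hy
  set levels := fun S : Finset U =>
    Finset.univ.filter fun l : Fin D => 36 * S.card * k ^ (l : ℕ) ≤ k ^ D with hlevels
  set keys := (Finset.univ : Finset (Finset U)).filter fun S => S.Nonempty with hkeys
  have hcover : (Finset.univ.filter fun h => ¬ good h) ⊆
      keys.biUnion fun S => (levels S).biUnion fun l => captured b l S := by
    intro h hh
    have hnot := (Finset.mem_filter.1 hh).2
    simp only [hgood, not_forall, not_le] at hnot
    obtain ⟨l, S, F, hF, -, hSk, hlt⟩ := hnot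
    have hS : S.Nonempty := by
      rw [Finset.nonempty_iff_ne_empty]
      rintro rfl
      simp at hlt
    refine Finset.mem_biUnion.2 ⟨S, Finset.mem_filter.2 ⟨Finset.mem_univ _, hS⟩,
      Finset.mem_biUnion.2 ⟨l, Finset.mem_filter.2 ⟨Finset.mem_univ _, hSk⟩, ?_⟩⟩
    refine mem_captured_of_card_lt (by omega) (fun d hd => ?_) (le_trans ?_ hSk) hlt
    · have := hF d hd
      omega
    · gcongr
      omega
  have hcount : ((Finset.univ.filter fun h => ¬ good h).card : ℝ) ≤
      ∑ S ∈ keys, ∑ l ∈ levels S, ((captured (k := k) (c := 6 * b) b l S).card : ℝ) := by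
    exact_mod_cast (Finset.card_le_card hcover).trans
      (Finset.card_biUnion_le.trans (Finset.sum_le_sum fun S _ => Finset.card_biUnion_le))
  calc ((Finset.univ.filter fun h => ¬ good h).card : ℝ) / total
      ≤ (∑ S ∈ keys, ∑ l ∈ levels S, ((captured (k := k) (c := 6 * b) b l S).card : ℝ)) /
          total := by gcongr
    _ = ∑ S ∈ keys, ∑ l ∈ levels S,
          ((captured (k := k) (c := 6 * b) b l S).card : ℝ) / total := by
        simp only [Finset.sum_div]
    _ ≤ ∑ S ∈ keys, Real.exp (-b) / 18 * y ^ S.card := by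
        refine Finset.sum_le_sum fun S hS => ?_
        have h := sum_density_captured_le (D := D) hk (show 0 < b by omega)
          (Finset.mem_filter.1 hS).2
        rwa [hU] at h
    _ ≤ ∑ S : Finset U, Real.exp (-b) / 18 * y ^ S.card :=
        Finset.sum_le_sum_of_subset_of_nonneg (Finset.subset_univ _)
          fun _ _ _ => by positivity
    _ = Real.exp (-b) / 18 * (1 + y) ^ m := by
        have h := Fintype.sum_pow_mul_eq_add_pow U y 1
        simp only [one_pow, mul_one] at h
        rw [← Finset.mul_sum, h, hU, add_comm]
    _ ≤ 1 / m := exp_neg_mul_one_add_pow_le (by omega) hb hmb
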